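/- Every finite von Neumann algebra is clean: for every element T of a finite von Neumann algebra M there exists an idempotent P ∈ M such that T − P is invertible in M, and moreover ‖(T − P)^{-1}‖ ≤ 4. -/

import Mathlib

variable {H : Type*} [NormedAddCommGroup H] [InnerProductSpace ℂ H] [CompleteSpace H]

namespace VonNeumannAlgebra

open scoped InnerProductSpace

/-- A bounded operator commuting with the commutant of `M` lies in `M`. -/
theorem mem_of_forall_commutant {M : VonNeumannAlgebra H} {g : H →L[ℂ] H}
    (h : ∀ s ∈ M.commutant, Commute s g) : g ∈ M := by
  rw [← M.commutant_commutant, mem_commutant_iff]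
  exact h

theorem commute_of_mem {M : VonNeumannAlgebra H} {g s : H →L[ℂ] H}
    (hg : g ∈ M) (hs : s ∈ M.commutant) : Commute s g :=
  ((mem_commutant_iff.1 hs) g hg).symm

theorem smul_mem {M : VonNeumannAlgebra H} {g : H →L[ℂ] H} (c : ℂ) (hg : g ∈ M) : c • g ∈ M :=
  mem_of_forall_commutant fun _ hs => (commute_of_mem hg hs).smul_right c

theorem abs_mem {M : VonNeumannAlgebra H} {g : H →L[ℂ] H} (hg : g ∈ M) : CFC.abs g ∈ M :=
  mem_of_forall_commutant fun _ hs =>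
    (commute_of_mem hg hs).symm.cfcAbs_right (commute_of_mem hg (star_mem hs)).symm

theorem units_inv_mem {M : VonNeumannAlgebra H} {u : (H →L[ℂ] H)ˣ} (hu : (u : H →L[ℂ] H) ∈ M) :
    ((u⁻¹ : (H →L[ℂ] H)ˣ) : H →L[ℂ] H) ∈ M :=
  mem_of_forall_commutant fun _ hs => (commute_of_mem hu hs).units_inv_right

end VonNeumannAlgebra

namespace ContinuousLinearMap
open scoped InnerProductSpace

theorem norm_abs_apply (w : H →L[ℂ] H) (x : H) : ‖CFC.abs w x‖ = ‖w x‖ := by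
  have h (u : H →L[ℂ] H) : ‖u x‖ ^ 2 = RCLike.re ⟪(star u * u) x, x⟫_ℂ := by
    rw [mul_apply_eq_comp, star_eq_adjoint, adjoint_inner_left, inner_self_eq_norm_sq]
  have : ‖CFC.abs w x‖ ^ 2 = ‖w x‖ ^ 2 := by
    rw [h, h, (CFC.abs_nonneg w).isSelfAdjoint.star_eq, CFC.abs_mul_abs]
  exact (sq_eq_sq₀ (norm_nonneg _) (norm_nonneg _)).1 this

end ContinuousLinearMap

open scoped InnerProductSpace in
theorem Submodule.commute_starProjection {K : Submodule ℂ H} [K.HasOrthogonalProjection]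
    {g : H →L[ℂ] H} (h : ∀ x ∈ K, g x ∈ K) (h' : ∀ x ∈ K, star g x ∈ K) :
    Commute K.starProjection g := by
  ext v
  refine (Submodule.eq_starProjection_of_mem_orthogonal (h _ (K.starProjection_apply_mem v)) ?_)
  change g v - g (K.starProjection v) ∈ Kᗮ
  rw [← map_sub, Submodule.mem_orthogonal]
  intro u hu
  rw [← ContinuousLinearMap.adjoint_inner_left]
  exact (Submodule.mem_orthogonal _ _).1 (K.sub_starProjection_mem_orthogonal v) _ (h' u hu)

namespace VonNeumannAlgebra
open scoped InnerProductSpace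

/-- A subspace of `H × H` which is the graph of a partially defined isometry and is invariant
under the commutant of `M`. -/
structure IsIsometricGraph (M : VonNeumannAlgebra H) (G : Submodule ℂ (H × H)) : Prop where
  norm_eq : ∀ p ∈ G, ‖p.1‖ = ‖p.2‖
  map_mem : ∀ s ∈ M.commutant, ∀ p ∈ G, (s p.1, s p.2) ∈ G

theorem IsIsometricGraph.topologicalClosure {M : VonNeumannAlgebra H} {G : Submodule ℂ (H × H)}
    (hG : M.IsIsometricGraph G) : M.IsIsometricGraph G.topologicalClosure where
  norm_eq p hp := by
    have hc : IsClosed {p : H × H | ‖p.1‖ = ‖p.2‖} :=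
      isClosed_eq (by fun_prop) (by fun_prop)
    exact closure_minimal hG.norm_eq hc hp
  map_mem s hs p hp :=
    map_mem_closure (f := fun p : H × H => (s p.1, s p.2)) (by fun_prop) hp (hG.map_mem s hs)

theorem isIsometricGraph_range {M : VonNeumannAlgebra H} {Y : H →L[ℂ] H} (hY : Y ∈ M) :
    M.IsIsometricGraph ((CFC.abs Y).prod Y).range where
  norm_eq := by
    rintro _ ⟨x, rfl⟩
    exact ContinuousLinearMap.norm_abs_apply Y x
  map_mem := by
    rintro s hs _ ⟨x, rfl⟩
    exact ⟨s x, Prod.ext (DFunLike.congr_fun (commute_of_mem (abs_mem hY) hs) x).symm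
      (DFunLike.congr_fun (commute_of_mem hY hs) x).symm⟩

/-- A closed isometric graph invariant under the commutant is the graph of the restriction of a
partial isometry of `M` to its initial space. -/
theorem IsIsometricGraph.exists_mem {M : VonNeumannAlgebra H} {G : Submodule ℂ (H × H)}
    (hG : M.IsIsometricGraph G) (hc : IsClosed (G : Set (H × H))) :
    ∃ V ∈ M, (∀ p ∈ G, V p.1 = p.2) ∧ (∀ p ∈ G, (star V * V) p.1 = p.1) ∧
      ∀ x, ((star V * V) x, V x) ∈ G := by
  have : CompleteSpace G := hc.completeSpace_coe
  have hn (p : G) : ‖(p : H × H).1‖ = ‖p‖ := by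
    rw [Submodule.coe_norm, Prod.norm_def, ← hG.norm_eq p p.2, max_self]
  let π₁ : G →ₗᵢ[ℂ] H := ⟨(LinearMap.fst ℂ H H).comp G.subtype, hn⟩
  let π₂ : G →ₗᵢ[ℂ] H := ⟨(LinearMap.snd ℂ H H).comp G.subtype, fun p => by
    rw [← hn p]; exact (hG.norm_eq p p.2).symm⟩
  let D : Submodule ℂ H := π₁.range
  have hD : IsComplete (D : Set H) := by
    have h : (D : Set H) = Set.range π₁ := LinearMap.coe_range π₁.toLinearMap
    exact h ▸ π₁.isometry.isUniformInducing.isComplete_range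
  have : CompleteSpace D := hD.completeSpace_coe
  let φ : D →ₗᵢ[ℂ] H := π₂.comp π₁.equivRange.symm.toLinearIsometry
  have hφ (p : G) (hp : (p : H × H).1 ∈ D) : φ ⟨(p : H × H).1, hp⟩ = (p : H × H).2 := by
    have : π₁.equivRange.symm ⟨(p : H × H).1, hp⟩ = p := by
      rw [LinearIsometryEquiv.symm_apply_eq]; rfl
    change π₂ (π₁.equivRange.symm _) = _
    rw [this]; rfl
  have hmem (p : H × H) (hp : p ∈ G) : p.1 ∈ D := ⟨⟨p, hp⟩, rfl⟩
  let V : H →L[ℂ] H := φ.toContinuousLinearMap ∘L D.orthogonalProjectionOnto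
  have hV (p : H × H) (hp : p ∈ G) : V p.1 = p.2 := by
    have : D.orthogonalProjectionOnto p.1 = ⟨p.1, hmem p hp⟩ :=
      Submodule.orthogonalProjectionOnto_mem_subspace_eq_self (⟨p.1, hmem p hp⟩ : D)
    change φ (D.orthogonalProjectionOnto p.1) = _
    rw [this]; exact hφ ⟨p, hp⟩ _
  have hVV : star V * V = D.starProjection := by
    ext x
    refine ext_inner_right ℂ fun y => ?_
    rw [mul_apply_eq_comp, ContinuousLinearMap.star_eq_adjoint,
      ContinuousLinearMap.adjoint_inner_left]
    change ⟪φ (D.orthogonalProjectionOnto x), φ (D.orthogonalProjectionOnto y)⟫_ℂ = _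
    rw [LinearIsometry.inner_map_map, Submodule.coe_inner, ← Submodule.starProjection_apply,
      ← Submodule.starProjection_apply, ← Submodule.inner_starProjection_left_eq_right,
      ← mul_apply_eq_comp, D.isIdempotentElem_starProjection.eq]
  have hVD (x : H) : V (D.starProjection x) = V x := by
    change φ _ = φ _
    congr 1
    exact Submodule.orthogonalProjectionOnto_mem_subspace_eq_self _
  have hinv (s) (hs : s ∈ M.commutant) (x) (hx : x ∈ D) : s x ∈ D ∧ V (s x) = s (V x) := by
    obtain ⟨p, rfl⟩ := hx
    have := hG.map_mem s hs p p.2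
    refine ⟨hmem _ this, (hV _ this).trans ?_⟩
    exact congrArg s (hV p p.2).symm
  refine ⟨V, mem_of_forall_commutant fun s hs => ?_, hV, fun p hp => ?_, fun x => ?_⟩
  · have hcomm : Commute D.starProjection s :=
      Submodule.commute_starProjection (fun x hx => (hinv s hs x hx).1)
        fun x hx => (hinv _ (star_mem hs) x hx).1
    ext x
    change s (V x) = V (s x)
    rw [← hVD x, ← hVD (s x), ← (hinv s hs _ (D.starProjection_apply_mem x)).2]
    exact congrArg V (DFunLike.congr_fun hcomm x).symm
  · rw [hVV, Submodule.starProjection_eq_self_iff]; exact hmem p hp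
  · rw [hVV]
    obtain ⟨p, hp⟩ := D.starProjection_apply_mem x
    have hp' : (p : H × H).1 = D.starProjection x := hp
    have := p.2
    rwa [← hVD x, ← hp', hV p p.2]

theorem IsIsometricGraph.sSup {M : VonNeumannAlgebra H} {c : Set (Submodule ℂ (H × H))}
    (hc : ∀ G ∈ c, M.IsIsometricGraph G) (hchain : IsChain (· ≤ ·) c) (hne : c.Nonempty) :
    M.IsIsometricGraph (sSup c) where
  norm_eq p hp := by
    obtain ⟨G, hG, hp⟩ := (Submodule.mem_sSup_of_directed hne hchain.directedOn).1 hp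
    exact (hc G hG).norm_eq p hp
  map_mem s hs p hp := by
    obtain ⟨G, hG, hp⟩ := (Submodule.mem_sSup_of_directed hne hchain.directedOn).1 hp
    exact le_sSup hG ((hc G hG).map_mem s hs p hp)

theorem IsIsometricGraph.sup {M : VonNeumannAlgebra H} {G G' : Submodule ℂ (H × H)}
    (hG : M.IsIsometricGraph G) (hG' : M.IsIsometricGraph G')
    (h₁ : ∀ p ∈ G, ∀ q ∈ G', ⟪p.1, q.1⟫_ℂ = 0) (h₂ : ∀ p ∈ G, ∀ q ∈ G', ⟪p.2, q.2⟫_ℂ = 0) :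
    M.IsIsometricGraph (G ⊔ G') where
  norm_eq r hr := by
    obtain ⟨p, hp, q, hq, rfl⟩ := Submodule.mem_sup.1 hr
    have e₁ := norm_add_sq_eq_norm_sq_add_norm_sq_of_inner_eq_zero _ _ (h₁ p hp q hq)
    have e₂ := norm_add_sq_eq_norm_sq_add_norm_sq_of_inner_eq_zero _ _ (h₂ p hp q hq)
    rw [hG.norm_eq p hp, hG'.norm_eq q hq, ← e₂] at e₁
    exact (mul_self_inj_of_nonneg (norm_nonneg _) (norm_nonneg _)).1 e₁
  map_mem s hs r hr := by
    obtain ⟨p, hp, q, hq, rfl⟩ := Submodule.mem_sup.1 hr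
    have := Submodule.add_mem_sup (hG.map_mem s hs p hp) (hG'.map_mem s hs q hq)
    simpa using this

/-- Polar decomposition, with a partial isometry that is maximal in the sense that no part of its
cokernel is equivalent in `M` to a part of its kernel. -/
theorem exists_maximal_polar {M : VonNeumannAlgebra H} {Y : H →L[ℂ] H} (hY : Y ∈ M) :
    ∃ V ∈ M, V * (star V * V) = V ∧ V * CFC.abs Y = Y ∧
      ∀ m ∈ M, (1 - V * star V) * m * (1 - star V * V) = 0 := by
  obtain ⟨G, hYG, hG, hmax⟩ := zorn_le_nonempty₀ {G | M.IsIsometricGraph G}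
    (fun c hc hchain G hG => ⟨sSup c, IsIsometricGraph.sSup hc hchain ⟨G, hG⟩,
      fun _ => le_sSup⟩) _ (isIsometricGraph_range hY)
  have hcl : IsClosed (G : Set (H × H)) := by
    have h := hmax hG.topologicalClosure G.le_topologicalClosure
    rw [← le_antisymm h G.le_topologicalClosure]
    exact G.isClosed_topologicalClosure
  obtain ⟨V, hVM, hV, hVV, hVG⟩ := hG.exists_mem hcl
  have hVVV : V * (star V * V) = V := by
    ext x
    exact hV _ (hVG x)
  refine ⟨V, hVM, hVVV, ?_, fun m hm => ?_⟩
  · ext x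
    exact hV _ (hYG ⟨x, rfl⟩)
  set e := star V * V with he
  have hes : star e = e := by simp [he]
  have hVs : star V * (1 - V * star V) = 0 := by
    have := congrArg star hVVV
    rw [star_mul, hes, he] at this
    rw [mul_sub, mul_one, ← mul_assoc, this, sub_self]
  set w := (1 - V * star V) * m * (1 - e) with hw
  have hwM : w ∈ M := by
    have hs := star_mem hVM
    exact mul_mem (mul_mem (sub_mem (one_mem _) (mul_mem hVM hs)) hm)
      (sub_mem (one_mem _) (mul_mem hs hVM))
  have hee : e * e = e := by rw [he, mul_assoc, hVVV]
  have hwe : w * e = 0 := by rw [hw, mul_assoc, sub_mul 1 e e, one_mul, hee, sub_self, mul_zero]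
  have hVw : star V * w = 0 := by rw [hw, mul_assoc, ← mul_assoc, hVs, zero_mul]
  have habs : e * CFC.abs w = 0 := by
    have h : CFC.abs w * e = 0 := by
      ext x
      refine norm_eq_zero.1 ?_
      rw [mul_apply_eq_comp, ContinuousLinearMap.norm_abs_apply, ← mul_apply_eq_comp, hwe]
      simp
    have := congrArg star h
    rwa [star_mul, hes, (CFC.abs_nonneg w).isSelfAdjoint.star_eq, star_zero] at this
  have hsup := hG.sup (isIsometricGraph_range hwM) ?_ ?_
  · have hle := hmax hsup le_sup_left
    rw [← CFC.abs_eq_zero_iff]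
    ext x
    have := hVV _ (hle (Submodule.mem_sup_right ⟨x, rfl⟩))
    exact this.symm.trans (DFunLike.congr_fun habs x)
  · rintro p hp _ ⟨x, rfl⟩
    rw [← hVV p hp, ← hes, ContinuousLinearMap.star_eq_adjoint,
      ContinuousLinearMap.adjoint_inner_left]
    change ⟪_, (e * CFC.abs w) x⟫_ℂ = 0
    rw [habs]
    simp
  · rintro p hp _ ⟨x, rfl⟩
    rw [← hV p hp, ← ContinuousLinearMap.adjoint_inner_right,
      ← ContinuousLinearMap.star_eq_adjoint]
    change ⟪_, (star V * w) x⟫_ℂ = 0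
    rw [hVw]
    simp

/-- In a finite von Neumann algebra, every element has a polar decomposition whose isometric part
is unitary. -/
theorem exists_unitary_polar {M : VonNeumannAlgebra H}
    (hfin : ∀ V ∈ M, star V * V = (1 : H →L[ℂ] H) → V * star V = 1)
    {Y : H →L[ℂ] H} (hY : Y ∈ M) :
    ∃ V ∈ M, star V * V = 1 ∧ V * star V = 1 ∧ V * CFC.abs Y = Y := by
  obtain ⟨V, hVM, hVVV, hVY, hmax⟩ := exists_maximal_polar hY
  suffices h : star V * V = 1 from ⟨V, hVM, h, hfin V hVM h, hVY⟩
  have hsM := star_mem hVM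
  let K : Submodule ℂ H := ⨅ m : M, ((1 - star V * V) * (m : H →L[ℂ] H)).ker
  have hK (v : H) : v ∈ K ↔ ∀ m ∈ M, (1 - star V * V) (m v) = 0 := by
    simp only [K, Submodule.mem_iInf, Subtype.forall]
    rfl
  have hKc : IsClosed (K : Set H) := by
    simp only [K, Submodule.coe_iInf]
    exact isClosed_iInter fun m => ContinuousLinearMap.isClosed_ker _
  have : CompleteSpace K := hKc.completeSpace_coe
  have hKM (g) (hg : g ∈ M) (v) (hv : v ∈ K) : g v ∈ K :=
    (hK _).2 fun m hm => (hK v).1 hv (m * g) (mul_mem hm hg)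
  have hKM' (s) (hs : s ∈ M.commutant) (v) (hv : v ∈ K) : s v ∈ K := by
    refine (hK _).2 fun m hm => ?_
    have hc : Commute s ((1 - star V * V) * m) := commute_of_mem
      (mul_mem (sub_mem (one_mem _) (mul_mem hsM hVM)) hm) hs
    have := DFunLike.congr_fun hc v
    have h0 := (hK v).1 hv m hm
    simp only [mul_apply_eq_comp] at this
    rw [← this, h0, map_zero]
  let q := K.starProjection
  have hqq : q * q = q := K.isIdempotentElem_starProjection
  have hqs : star q = q := isSelfAdjoint_starProjection K
  have hqM : q ∈ M := mem_of_forall_commutant fun s hs =>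
    (Submodule.commute_starProjection (hKM' s hs) (hKM' _ (star_mem hs))).symm
  have hqV : q * V = V * q := Submodule.commute_starProjection (hKM V hVM) (hKM _ hsM)
  have hqV' : q * star V = star V * q := by simpa [hqs] using (congrArg star hqV).symm
  have hqe : (1 - star V * V) * q = 0 := by
    ext x
    exact (hK _).1 (K.starProjection_apply_mem x) 1 (one_mem _)
  have hqf : q * (1 - V * star V) = 1 - V * star V := by
    ext x
    refine Submodule.starProjection_eq_self_iff.2 ((hK _).2 fun m hm => ?_)
    have := congrArg star (hmax _ (star_mem hm))
    simp only [star_mul, star_sub, star_one, star_star, star_zero, ← mul_assoc] at this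
    exact DFunLike.congr_fun this x
  have hqf' : (1 - q) * (1 - V * star V) = 0 := by rw [sub_mul 1 q, hqf, one_mul, sub_self]
  have h₁ : (1 - q) * V * q = 0 := by
    linear_combination (norm := noncomm_ring) -(1 - q) * hqV - hqq * V
  have h₂ : q * star V * (1 - q) = 0 := by
    linear_combination (norm := noncomm_ring) hqV' * (1 - q) - star V * hqq
  have hI := hfin (star V * (1 - q) + q) (add_mem (mul_mem hsM (sub_mem (one_mem _) hqM)) hqM) (by
    simp only [star_add, star_mul, star_sub, star_one, star_star, hqs]
    linear_combination (norm := noncomm_ring) -hqf' * (1 - q) + h₁ + h₂ + 2 * hqq)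
  simp only [star_add, star_mul, star_sub, star_one, star_star, hqs] at hI
  linear_combination (norm := noncomm_ring)
    hI + star V * hqV - hqe - star V * hqq * V + star V * hqq + hqq * V - hqq

/-- The spectral projection of `|T|` for the interval `[0, 1 / 2]`. -/
theorem exists_spectral_projection {M : VonNeumannAlgebra H} {T : H →L[ℂ] H} (hT : T ∈ M) :
    ∃ E ∈ M, star E = E ∧ E * E = E ∧ Commute E (CFC.abs T) ∧
      (∀ x, ‖T (E x)‖ ≤ 1 / 2 * ‖E x‖) ∧ ∀ x, 1 / 2 * ‖(1 - E) x‖ ≤ ‖T ((1 - E) x)‖ := by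
  set h : H →L[ℂ] H := star T * T - (1 / 4 : ℂ) • 1 with hh
  have hsa : IsSelfAdjoint h := by
    simp [h, IsSelfAdjoint]
  have hcomm {g : H →L[ℂ] H} (hg : Commute (star T * T) g) : Commute h⁺ g := by
    refine Commute.cfcₙ_real (hg.sub_left ?_) _
    exact (Commute.one_left g).smul_left _
  have : CompleteSpace h⁺.ker := h⁺.isClosed_ker.completeSpace_coe
  have hEcomm {g : H →L[ℂ] H} (hg : Commute h⁺ g) (hg' : Commute h⁺ (star g)) :
      Commute h⁺.ker.starProjection g := by
    have key {g : H →L[ℂ] H} (hg : Commute h⁺ g) (x) (hx : x ∈ h⁺.ker) : g x ∈ h⁺.ker := by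
      have h₁ : h⁺ x = 0 := hx
      have h₂ : h⁺ (g x) = g (h⁺ x) := DFunLike.congr_fun hg x
      change h⁺ (g x) = 0
      rw [h₂, h₁, map_zero]
    exact Submodule.commute_starProjection (key hg) (key hg')
  have hM : star T * T ∈ M := mul_mem (star_mem hT) hT
  set E := h⁺.ker.starProjection with hE
  have hEs : star E = E := isSelfAdjoint_starProjection _
  have hEE : E * E = E := h⁺.ker.isIdempotentElem_starProjection
  have hdecomp : h⁺ - h⁻ = h := CFC.posPart_sub_negPart h
  have hposE (x) : h⁺ (E x) = 0 := h⁺.ker.starProjection_apply_mem x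
  have hEneg : E * h⁻ = h⁻ := by
    ext x
    exact Submodule.starProjection_eq_self_iff.2 (DFunLike.congr_fun (CFC.posPart_mul_negPart h) x)
  have hnegE : h⁻ * (1 - E) = 0 := by
    have := congrArg star hEneg
    rw [star_mul, hEs, (CFC.negPart_nonneg h).isSelfAdjoint.star_eq] at this
    rw [mul_sub, mul_one, this, sub_self]
  have hnorm (x : H) : ‖T x‖ ^ 2 - (1 / 2 * ‖x‖) ^ 2 = RCLike.re ⟪h x, x⟫_ℂ := by
    have h₁ : ⟪h x, x⟫_ℂ = ⟪T x, T x⟫_ℂ - (1 / 4 : ℂ) * ⟪x, x⟫_ℂ := by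
      rw [hh]
      simp only [sub_apply, smul_apply, inner_sub_left,
        mul_apply_eq_comp, ContinuousLinearMap.star_eq_adjoint,
        ContinuousLinearMap.adjoint_inner_left, inner_smul_left]
      simp [Complex.conj_ofNat]
    have h₂ : (1 / 4 : ℂ) = ((1 / 4 : ℝ) : ℂ) := by norm_num
    rw [h₁, inner_self_eq_norm_sq_to_K, inner_self_eq_norm_sq_to_K, h₂]
    simp only [RCLike.re_to_complex, Complex.coe_algebraMap]
    norm_cast
    ring
  have hpos (a : H →L[ℂ] H) (ha : 0 ≤ a) (x : H) : 0 ≤ RCLike.re ⟪a x, x⟫_ℂ :=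
    ((ContinuousLinearMap.nonneg_iff_isPositive a).1 ha).re_inner_nonneg_left x
  refine ⟨E, mem_of_forall_commutant fun s hs => ?_, hEs, hEE, ?_, fun x => ?_, fun x => ?_⟩
  · exact (hEcomm (hcomm (commute_of_mem hM hs).symm)
      (hcomm (commute_of_mem hM (star_mem hs)).symm)).symm
  · have hc : Commute (star T * T) (CFC.abs T) := by
      rw [← CFC.abs_mul_abs]
      exact (Commute.refl _).mul_left (Commute.refl _)
    refine hEcomm (hcomm hc) ?_
    rw [(CFC.abs_nonneg T).isSelfAdjoint.star_eq]
    exact hcomm hc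
  · have h₁ := hnorm (E x)
    have h₂ := hpos _ (CFC.negPart_nonneg h) (E x)
    rw [← hdecomp, sub_apply, hposE, zero_sub, inner_neg_left, map_neg] at h₁
    exact le_of_sq_le_sq (by linarith) (by positivity)
  · have h₁ := hnorm ((1 - E) x)
    have h₂ := hpos _ (CFC.posPart_nonneg h) ((1 - E) x)
    have h₃ : h⁻ ((1 - E) x) = 0 := DFunLike.congr_fun hnegE x
    generalize (1 - E) x = y at h₁ h₂ h₃ ⊢
    rw [← hdecomp, sub_apply, h₃, sub_zero] at h₁
    exact le_of_sq_le_sq (by linarith) (by positivity)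

/-- In a finite von Neumann algebra, elements bounded below are invertible. -/
theorem exists_inverse_of_bounded_below {M : VonNeumannAlgebra H}
    (hfin : ∀ V ∈ M, star V * V = (1 : H →L[ℂ] H) → V * star V = 1)
    {X : H →L[ℂ] H} (hX : X ∈ M) {C : ℝ} (hC : 0 < C) (hb : ∀ x, ‖x‖ ≤ C * ‖X x‖) :
    ∃ S ∈ M, S * X = 1 ∧ X * S = 1 ∧ ‖S‖ ≤ C := by
  obtain ⟨V, -, hV, hV', hVX⟩ := exists_unitary_polar hfin hX
  have hunit : IsUnit (CFC.abs X * CFC.abs X) := by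
    refine ContinuousLinearMap.isUnit_of_forall_le_norm_inner_map _
      (c := ⟨(C ^ 2)⁻¹, by positivity⟩) (by change 0 < (C ^ 2)⁻¹; positivity) fun x => ?_
    rw [CFC.abs_mul_abs, mul_apply_eq_comp, ContinuousLinearMap.star_eq_adjoint,
      ContinuousLinearMap.adjoint_inner_left, inner_self_eq_norm_sq_to_K]
    have := pow_le_pow_left₀ (norm_nonneg _) (hb x) 2
    change ‖x‖ ^ 2 * (C ^ 2)⁻¹ ≤ _
    rw [← div_eq_mul_inv, div_le_iff₀ (by positivity)]
    simpa [mul_pow, mul_comm] using this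
  have habs : IsUnit (CFC.abs X) := ((Commute.refl _).isUnit_mul_iff.1 hunit).1
  have hXu : IsUnit X := by
    rw [← hVX]
    exact (isUnit_iff_exists.2 ⟨star V, hV', hV⟩).mul habs
  obtain ⟨u, rfl⟩ := hXu
  refine ⟨_, units_inv_mem hX, u.inv_mul, u.mul_inv,
    ContinuousLinearMap.opNorm_le_bound _ hC.le fun x => ?_⟩
  have := hb (((u⁻¹ : (H →L[ℂ] H)ˣ) : H →L[ℂ] H) x)
  rwa [← mul_apply_eq_comp, u.mul_inv] at this

/-- If a unitary `V` satisfies `V |Y| = Y`, and self-adjoint `E` and `F` satisfy `E Y = Y F` and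
are the identity on the kernels of `Y*` and `Y`, then `E V = V F`. -/
theorem mul_eq_mul_of_polar {Y V E F : H →L[ℂ] H} (hV : star V * V = 1)
    (hVY : V * CFC.abs Y = Y) (hE : star E = E) (hF : star F = F) (hEF : E * Y = Y * F)
    (hkerE : ∀ x, star Y x = 0 → E x = x) (hkerF : ∀ x, Y x = 0 → F x = x) :
    E * V = V * F := by
  have hFabs : Commute F (CFC.abs Y) := by
    have h : Commute (star Y * Y) F := by
      have := congrArg star hEF
      rw [star_mul, star_mul, hE, hF] at this
      rw [commute_iff_eq, mul_assoc, ← hEF, ← mul_assoc, this, mul_assoc]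
    exact (Commute.cfcₙ_nnreal h _).symm
  have hstar : star Y = CFC.abs Y * star V := by
    conv_lhs => rw [← hVY]
    rw [star_mul, (CFC.abs_nonneg Y).isSelfAdjoint.star_eq]
  have hJ : CFC.abs Y * star (E * V - V * F) = 0 := by
    have h : (E * V - V * F) * CFC.abs Y = 0 := by
      rw [sub_mul, mul_assoc, hVY, mul_assoc, hFabs.eq, ← mul_assoc, hVY, hEF, sub_self]
    have := congrArg star h
    rwa [star_mul, (CFC.abs_nonneg Y).isSelfAdjoint.star_eq, star_zero] at this
  have hker (x) (hx : CFC.abs Y x = 0) : (E * V - V * F) x = 0 := by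
    have h₁ : Y x = 0 := by rw [← hVY, mul_apply_eq_comp, hx, map_zero]
    have h₂ : star Y (V x) = 0 := by
      rw [← mul_apply_eq_comp, hstar, mul_assoc, hV, mul_one, hx]
    rw [sub_apply, mul_apply_eq_comp, mul_apply_eq_comp, hkerF x h₁, hkerE _ h₂, sub_self]
  rw [← sub_eq_zero, ← CStarRing.mul_star_self_eq_zero_iff]
  ext x
  exact hker _ (DFunLike.congr_fun hJ x)

/-- For a positive contraction `c`, the element `c + (1 - c²) / 2` is an invertible contraction. -/
theorem isUnit_and_norm_le_one_of_nonneg {A : Type*} [CStarAlgebra A] [PartialOrder A]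
    [StarOrderedRing A] {c : A} (hc : 0 ≤ c) (hc1 : ‖c‖ ≤ 1) :
    IsUnit (c + (1 / 2 : ℂ) • (1 - c * c)) ∧ ‖c + (1 / 2 : ℂ) • (1 - c * c)‖ ≤ 1 := by
  nontriviality A
  have hle : c ≤ 1 := (CStarAlgebra.norm_le_one_iff_of_nonneg c hc).1 hc1
  have hd : 0 ≤ 1 - c := sub_nonneg.2 hle
  have hd1 : ‖1 - c‖ ≤ 1 := (CStarAlgebra.norm_le_one_iff_of_nonneg _ hd).2 (sub_le_self _ hc)
  set r : A := (1 / 2 : ℂ) • ((1 - c) * (1 - c)) with hr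
  have hD : c + (1 / 2 : ℂ) • (1 - c * c) = 1 - r := by
    rw [hr]
    have : (1 - c) * (1 - c) = (2 : ℂ) • 1 - (2 : ℂ) • c - (1 - c * c) := by
      rw [two_smul, two_smul]; noncomm_ring
    rw [this]
    module
  have hrn : ‖r‖ ≤ 1 / 2 := by
    rw [hr, norm_smul]
    have h₁ := (norm_mul_le (1 - c) (1 - c)).trans (mul_le_one₀ hd1 (norm_nonneg _) hd1)
    have h₂ : ‖(1 / 2 : ℂ)‖ = 1 / 2 := by norm_num
    rw [h₂]
    linarith
  have hr0 : 0 ≤ r := by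
    have h : 0 ≤ (1 - c) * (1 - c) := by
      simpa only [hd.isSelfAdjoint.star_eq] using star_mul_self_nonneg (1 - c)
    have h' : r = (1 / 2 : ℝ) • ((1 - c) * (1 - c)) := by
      rw [hr, ← Complex.coe_smul]
      norm_num
    rw [h']
    exact smul_nonneg (by norm_num) h
  have hr1 : r ≤ 1 := (CStarAlgebra.norm_le_one_iff_of_nonneg r hr0).1 (by linarith)
  rw [hD]
  exact ⟨isUnit_one_sub_of_norm_lt_one (by linarith),
    (CStarAlgebra.norm_le_one_iff_of_nonneg _ (sub_nonneg.2 hr1)).2 (sub_le_self _ hr0)⟩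

theorem norm_sq_eq_of_isSelfAdjoint_of_isIdempotentElem {E : H →L[ℂ] H} (hE : star E = E)
    (hEE : E * E = E) (x : H) : ‖x‖ ^ 2 = ‖(1 - E) x‖ ^ 2 + ‖E x‖ ^ 2 := by
  have h : ⟪(1 - E) x, E x⟫_ℂ = 0 := by
    rw [← ContinuousLinearMap.adjoint_inner_left, ← ContinuousLinearMap.star_eq_adjoint, hE,
      ← mul_apply_eq_comp, mul_sub, mul_one, hEE, sub_self]
    simp
  have := norm_add_sq_eq_norm_sq_add_norm_sq_of_inner_eq_zero _ _ h
  rw [← add_apply, sub_add_cancel] at this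
  simpa [sq] using this

/-- If `E` and `F` are projections of `M` cutting off the part of `T` of norm at most `1 / 2`,
and the unitary `V` of `M` maps the range of `F` onto that of `E`, there are idempotents `P` and `R`
of `M` with the same kernel, with ranges those of `F` and `E`. -/
theorem exists_idempotents {M : VonNeumannAlgebra H} {E F V c : H →L[ℂ] H}
    (hEM : E ∈ M) (hFM : F ∈ M) (hVM : V ∈ M) (hcM : c ∈ M)
    (hE : star E = E) (hF : star F = F) (hEE : E * E = E) (hFF : F * F = F)
    (hV : star V * V = 1) (hV' : V * star V = 1) (hEV : E * V = V * F)
    (hc : 0 ≤ c) (hcF : c * F = c) (hVc : V * c = E * F) :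
    ∃ P ∈ M, ∃ R ∈ M, IsIdempotentElem P ∧ F * P = P ∧ R * P = R ∧
      (∀ x, ‖R (F x)‖ ≤ ‖F x‖) ∧ ∀ x, ‖R x - E x‖ ≤ 1 / 2 * ‖(1 - E) x‖ := by
  have hFc : F * c = c := by
    simpa [hF, hc.isSelfAdjoint.star_eq] using congrArg star hcF
  have hcc : c * c = F * E * F := by
    have h := congrArg star hVc
    rw [star_mul, star_mul, hc.isSelfAdjoint.star_eq, hE, hF] at h
    linear_combination (norm := noncomm_ring) h * V * c + F * E * hVc + F * hEE * F - c * hV * c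
  have hV_norm (x : H) : ‖V x‖ = ‖x‖ :=
    (ContinuousLinearMap.norm_map_iff_adjoint_comp_self V).2 hV x
  have hle {G : H →L[ℂ] H} (hG : star G = G) (hGG : G * G = G) (x : H) : ‖G x‖ ≤ ‖x‖ := by
    have := norm_sq_eq_of_isSelfAdjoint_of_isIdempotentElem hG hGG x
    exact le_of_sq_le_sq (by nlinarith [sq_nonneg ‖(1 - G) x‖]) (norm_nonneg _)
  have hc1 : ‖c‖ ≤ 1 := ContinuousLinearMap.opNorm_le_bound _ zero_le_one fun x => by
    rw [one_mul, ← hV_norm, ← mul_apply_eq_comp, hVc, mul_apply_eq_comp]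
    exact (hle hE hEE _).trans (hle hF hFF _)
  obtain ⟨⟨u, hu⟩, hD1⟩ := isUnit_and_norm_le_one_of_nonneg hc hc1
  set D := c + (1 / 2 : ℂ) • (1 - c * c) with hD
  have hDM : D ∈ M :=
    add_mem hcM (smul_mem _ (sub_mem (one_mem _) (mul_mem hcM hcM)))
  have hDF : Commute D F := by
    have h : Commute c F := hcF.trans hFc.symm
    exact h.add_left (((Commute.one_left F).sub_left (h.mul_left h)).smul_left _)
  set D' : H →L[ℂ] H := ((u⁻¹ : (H →L[ℂ] H)ˣ) : H →L[ℂ] H) with hD'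
  have hDD' : D * D' = 1 := by rw [← hu, hD', u.mul_inv]
  have hD'F : D' * F = F * D' := by
    rw [← hu] at hDF
    exact hDF.units_inv_left
  have hD'M : D' ∈ M := units_inv_mem (hu ▸ hDM)
  set R := E + (1 / 2 : ℂ) • (E * V * (1 - E)) with hR
  have hRM : R ∈ M := add_mem hEM
    (smul_mem _ (mul_mem (mul_mem hEM hVM) (sub_mem (one_mem _) hEM)))
  have hER : E * R = R := by
    rw [hR, mul_add, mul_smul_comm, ← mul_assoc, ← mul_assoc, hEE]
  have hRF : R * F = V * D * F := by
    have h₁ : V * D * F = V * c + (1 / 2 : ℂ) • (V * (F - F * E * F)) := by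
      have : D * F = c + (1 / 2 : ℂ) • (F - F * E * F) := by
        rw [hD, add_mul, hcF, smul_mul_assoc, sub_mul, one_mul, mul_assoc, hcF, hcc]
      rw [mul_assoc, this, mul_add, mul_smul_comm]
    have h₂ : E * V * (1 - E) * F = V * (F - F * E * F) := by
      rw [hEV]
      linear_combination (norm := noncomm_ring) V * hFF
    rw [h₁, hR, add_mul, smul_mul_assoc, h₂, hVc]
  have hRD : R * (D' * F * star V) = E := by
    calc R * (D' * F * star V) = R * F * D' * star V := by rw [hD'F]; simp only [mul_assoc]
      _ = V * F * (D * D') * star V := by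
        rw [hRF, mul_assoc V D F, hDF.eq]; simp only [mul_assoc]
      _ = E := by rw [hDD', mul_one, ← hEV, mul_assoc, hV', mul_one]
  have hRP : R * (D' * F * star V * R) = R := by rw [← mul_assoc, hRD, hER]
  refine ⟨D' * F * star V * R,
    mul_mem (mul_mem (mul_mem hD'M hFM) (star_mem hVM)) hRM, R, hRM, ?_, ?_, hRP, ?_, ?_⟩
  · rw [IsIdempotentElem, mul_assoc, hRP]
  · linear_combination (norm := noncomm_ring)
      -hD'F * F * star V * R + D' * hFF * star V * R
  · intro x
    have : R (F x) = V (D (F x)) := DFunLike.congr_fun hRF x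
    rw [this, hV_norm]
    exact (D.le_opNorm _).trans (mul_le_of_le_one_left (norm_nonneg _) hD1)
  · intro x
    have : R x - E x = (1 / 2 : ℂ) • E (V ((1 - E) x)) := by
      rw [hR, add_apply, add_sub_cancel_left]
      rfl
    have h2 : ‖(1 / 2 : ℂ)‖ = 1 / 2 := by norm_num
    rw [this, norm_smul, h2, ← hV_norm ((1 - E) x)]
    exact mul_le_mul_of_nonneg_left (hle hE hEE _) (by norm_num)

end VonNeumannAlgebra

open VonNeumannAlgebra

/-- Every finite von Neumann algebra is clean, with the inverse of norm at most `4`: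
here finiteness is expressed by the condition that every isometry in `M` is unitary. -/
theorem stmt11 (M : VonNeumannAlgebra H)
    (hfin : ∀ V ∈ M, star V * V = (1 : H →L[ℂ] H) → V * star V = 1) :
    ∀ T ∈ M, ∃ P ∈ M, IsIdempotentElem P ∧
      ∃ S ∈ M, S * (T - P) = 1 ∧ (T - P) * S = 1 ∧ ‖S‖ ≤ 4 := by
  intro T hT
  obtain ⟨E, hEM, hE, hEE, hEabs, hTE, hTE'⟩ := exists_spectral_projection hT
  obtain ⟨U, hUM, hU, hU', hUT⟩ := exists_unitary_polar hfin hT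
  set F := U * E * star U with hFdef
  have hFM : F ∈ M := mul_mem (mul_mem hUM hEM) (star_mem hUM)
  have hF : star F = F := by simp [F, hE, mul_assoc]
  have hFF : F * F = F := by
    linear_combination (norm := (rw [hFdef]; noncomm_ring)) U * E * hU * E * star U +
      U * hEE * star U
  have hFT : F * T = T * E := by
    rw [← hUT]
    linear_combination (norm := (rw [hFdef]; noncomm_ring)) U * E * hU * CFC.abs T + U * hEabs.eq
  have hTF : E * star T = star T * F := by simpa [hE, hF] using (congrArg star hFT).symm
  have hTstar : star T = CFC.abs T * star U := by
    conv_lhs => rw [← hUT]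
    rw [star_mul, (CFC.abs_nonneg T).isSelfAdjoint.star_eq]
  set Y := E * F + (1 - E) * star T with hY
  have hYM : Y ∈ M := add_mem (mul_mem hEM hFM)
    (mul_mem (sub_mem (one_mem _) hEM) (star_mem hT))
  obtain ⟨V, hVM, hV, hV', hVY⟩ := exists_unitary_polar hfin hYM
  have hEY : E * Y = Y * F := by
    linear_combination (norm := (rw [hY]; noncomm_ring)) hEE * F - E * hFF +
      (1 - E) * hTF
  have hU_norm (x : H) : ‖U x‖ = ‖x‖ :=
    (ContinuousLinearMap.norm_map_iff_adjoint_comp_self U).2 hU x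
  have hTstar_norm (x : H) : 1 / 2 * ‖(1 - F) x‖ ≤ ‖star T ((1 - F) x)‖ := by
    have h : (1 - F) = U * (1 - E) * star U := by
      linear_combination (norm := (rw [hFdef]; noncomm_ring)) -hU'
    have h₁ : (1 - F) x = U ((1 - E) (star U x)) := by rw [h]; rfl
    have h₂ : star T ((1 - F) x) = CFC.abs T ((1 - E) (star U x)) := by
      rw [h₁, ← mul_apply_eq_comp, hTstar, mul_assoc, hU, mul_one]
    rw [h₂, h₁, hU_norm, ContinuousLinearMap.norm_abs_apply]
    exact hTE' _
  have hEV : E * V = V * F := by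
    refine mul_eq_mul_of_polar hV hVY hE hF hEY (fun x hx => ?_) fun x hx => ?_
    · have h : T * (1 - E) = (1 - F) * star Y := by
        have : star Y = F * E + T * (1 - E) := by simp [hY, hE, hF]
        rw [this]
        linear_combination (norm := noncomm_ring) hFT * (1 - E) - T * hEE + hFF * E
      have h₁ := hTE' x
      rw [← mul_apply_eq_comp, h, mul_apply_eq_comp, hx, map_zero, norm_zero] at h₁
      have h₂ : (1 - E) x = 0 := norm_eq_zero.1 (by linarith [norm_nonneg ((1 - E) x)])
      exact (sub_eq_zero.1 h₂).symm
    · have h : star T * (1 - F) = (1 - E) * Y := by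
        linear_combination (norm := (rw [hY]; noncomm_ring)) hTF - hEE * star T + hEE * F
      have h₁ := hTstar_norm x
      rw [← mul_apply_eq_comp, h, mul_apply_eq_comp, hx, map_zero, norm_zero] at h₁
      have h₂ : (1 - F) x = 0 := norm_eq_zero.1 (by linarith [norm_nonneg ((1 - F) x)])
      exact (sub_eq_zero.1 h₂).symm
  have hFabs : Commute (CFC.abs Y) F := by
    refine Commute.cfcₙ_nnreal ?_ _
    have := congrArg star hEY
    rw [star_mul, star_mul, hE, hF] at this
    rw [commute_iff_eq, mul_assoc, ← hEY, ← mul_assoc, this, mul_assoc]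
  have hc : 0 ≤ CFC.abs Y * F := by
    have := star_left_conjugate_nonneg (CFC.abs_nonneg Y) F
    rwa [hF, ← hFabs.eq, mul_assoc, hFF] at this
  have hVc : V * (CFC.abs Y * F) = E * F := by
    rw [← mul_assoc, hVY]
    linear_combination (norm := (rw [hY]; noncomm_ring)) E * hFF - (1 - E) * hTF - hEE * star T
  obtain ⟨P, hPM, R, hRM, hPP, hFP, hRP, hRF, hRE⟩ := exists_idempotents hEM hFM hVM
    (mul_mem (abs_mem hYM) hFM) hE hF hEE hFF hV hV' hEV hc (by rw [mul_assoc, hFF]) hVc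
  refine ⟨P, hPM, hPP, exists_inverse_of_bounded_below hfin (sub_mem hT hPM) (by norm_num)
    fun x => ?_⟩
  set y := (T - P) x with hy
  have h₁ : (1 - F) y = T ((1 - E) x) := by
    have : (1 - F) * (T - P) = T * (1 - E) := by
      linear_combination (norm := noncomm_ring) -hFT + hFP
    exact DFunLike.congr_fun this x
  have h₂ : R (F y) = R (F (T (E x))) - R x := by
    have : R * F * (T - P) = R * F * T * E - R := by
      linear_combination (norm := noncomm_ring) R * hFT - R * hFT * E - R * T * hEE - R * hFP - hRP
    exact DFunLike.congr_fun this x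
  have hFTE : F (T (E x)) = T (E x) := by
    have : F * T * E = T * E := by rw [hFT, mul_assoc, hEE]
    exact DFunLike.congr_fun this x
  have ha : 1 / 2 * ‖(1 - E) x‖ ≤ ‖(1 - F) y‖ := h₁ ▸ hTE' x
  have hb : ‖E x‖ ≤ 2 * ‖F y‖ + ‖(1 - E) x‖ := by
    have e : E x = R (F (T (E x))) - R (F y) - (R x - E x) := by rw [h₂]; abel
    have n₁ := norm_sub_le (R (F (T (E x))) - R (F y)) (R x - E x)
    have n₂ := norm_sub_le (R (F (T (E x)))) (R (F y))
    rw [← e] at n₁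
    have n₃ := hRF (T (E x))
    rw [hFTE] at n₃ n₂ n₁
    linarith [hRF y, hRE x, hTE x]
  have hx := norm_sq_eq_of_isSelfAdjoint_of_isIdempotentElem hE hEE x
  have hy' := norm_sq_eq_of_isSelfAdjoint_of_isIdempotentElem hF hFF y
  refine le_of_sq_le_sq ?_ (by positivity)
  rw [mul_pow, hx, hy']
  have hb' : ‖E x‖ ≤ 2 * (‖F y‖ + ‖(1 - F) y‖) := by linarith
  have s₁ := pow_le_pow_left₀ (norm_nonneg _) hb' 2
  have s₂ := pow_le_pow_left₀ (by positivity) ha 2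
  nlinarith [sq_nonneg (‖F y‖ - ‖(1 - F) y‖), sq_nonneg ‖F y‖]
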